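/- arXiv:2404.17911 — 2 statements merged into one kernel-verified Lean document; each statement's English description precedes it below -/
import Mathlib

section
/- Let x, y > 0 be real numbers such that y > 1/x if x ≤ 1 and y > 2 − x if x ≥ 1, and let α₀, α₁ be defined by α₀ := y − √(y(x+y−2)) if x ≤ 2, α₀ := 0 if x ≥ 2, and α₁ := y + √(y(x+y−2)) if y ≤ 1/x, α₁ := 1 if y ≥ 1/x. For α ∈ (α₀, α₁) set δ₀(α) := α/(x−2+2α) and δ₁(α) := y/α. Then the supremum of the set { α(2 − 1/δ − δ) : α ∈ (α₀, α₁), δ ∈ (δ₀(α), δ₁(α)) } equals 2 − x − 1/x if x ≤ 1 and equals 0 if x ≥ 1. -/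
open Filter Topology

/-- For `x ≤ 2` and `x + y > 2`, the lower root of `(x - 2) y + 2 α y - α²` is at least
`(2 - x) / 2`. -/
lemma half_le_lower_root {x y : ℝ} (hx2 : x ≤ 2) (hxy : 2 < x + y) :
    (2 - x) / 2 ≤ y - Real.sqrt (y * (x + y - 2)) := by
  have : Real.sqrt (y * (x + y - 2)) ≤ y - (2 - x) / 2 :=
    Real.sqrt_le_iff.2 ⟨by linarith, by nlinarith [sq_nonneg (2 - x)]⟩
  linarith

lemma lower_root_le_two_sub {x y : ℝ} (hx2 : x ≤ 2) (hxy : 2 < x + y) :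
    y - Real.sqrt (y * (x + y - 2)) ≤ 2 - x := by
  have : x + y - 2 ≤ Real.sqrt (y * (x + y - 2)) := Real.le_sqrt_of_sq_le (by nlinarith)
  linarith

lemma lower_root_lt_one {x y : ℝ} (hxy : 1 < x * y) :
    y - Real.sqrt (y * (x + y - 2)) < 1 := by
  have : y - 1 < Real.sqrt (y * (x + y - 2)) := Real.lt_sqrt_of_sq_lt (by nlinarith)
  linarith

lemma mul_two_sub_inv_sub_nonpos {a d : ℝ} (ha : 0 < a) (hd : 0 < d) :
    a * (2 - 1 / d - d) ≤ 0 := by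
  have h : a * (2 - 1 / d - d) = -(a * (d - 1) ^ 2 / d) := by field_simp; ring
  rw [h, neg_nonpos]
  positivity

lemma mul_two_sub_inv_sub_le {x a d : ℝ} (hx : 0 < x) (hx1 : x ≤ 1) (ha : 0 < a) (ha1 : a < 1)
    (hc : 0 < x - 2 + 2 * a) (hd : a / (x - 2 + 2 * a) < d) :
    a * (2 - 1 / d - d) ≤ 2 - x - 1 / x := by
  set c := x - 2 + 2 * a with hcdef
  set u := a / c with hu
  have hu1 : 1 ≤ u := (one_le_div hc).2 (by linarith)
  have hd0 : 0 < d := by linarith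
  have hmono : u + 1 / u ≤ d + 1 / d := by
    have h : d + 1 / d - (u + 1 / u) = (d - u) * (d * u - 1) / (d * u) := by
      field_simp
      ring
    have h' : 0 ≤ (d - u) * (d * u - 1) / (d * u) :=
      div_nonneg (mul_nonneg (by linarith) (by nlinarith)) (by positivity)
    linarith
  have hval : a * (2 - 1 / u - u) = 2 * a - c - a ^ 2 / c := by
    rw [hu]
    field_simp
  have hend : 1 / x ≤ a ^ 2 / c := by
    rw [div_le_div_iff₀ hx hc]
    have : 0 ≤ (1 - a) * (2 - x * (1 + a)) := mul_nonneg (by linarith) (by nlinarith)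
    rw [hcdef]
    linarith
  calc a * (2 - 1 / d - d) ≤ a * (2 - 1 / u - u) :=
        mul_le_mul_of_nonneg_left (by linarith) ha.le
    _ ≤ 2 - x - 1 / x := by rw [hval]; linarith

lemma isLUB_second_maximization {x y a₀ : ℝ} (hx : 0 < x) (hx1 : x ≤ 1) (hy : 1 / x < y)
    (h0 : (2 - x) / 2 ≤ a₀) (h1 : a₀ < 1) :
    IsLUB {z : ℝ | ∃ α ∈ Set.Ioo a₀ 1, ∃ δ ∈ Set.Ioo (α / (x - 2 + 2 * α)) (y / α),
      z = α * (2 - 1 / δ - δ)} (2 - x - 1 / x) := by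
  constructor
  · rintro z ⟨a, ⟨ha, ha1⟩, d, ⟨hd, -⟩, rfl⟩
    exact mul_two_sub_inv_sub_le hx hx1 (by linarith) ha1 (by linarith) hd
  · intro b hb
    let D : ℝ → ℝ := fun a => a / (x - 2 + 2 * a) + (1 - a)
    have hD1 : D 1 = 1 / x := by simp [D]
    have hDc : ContinuousAt D 1 := by
      have : x - 2 + 2 * (1 : ℝ) ≠ 0 := by linarith
      fun_prop (disch := assumption)
    have hDne : D 1 ≠ 0 := by rw [hD1]; positivity
    have hlim : Tendsto (fun a => a * (2 - 1 / D a - D a)) (𝓝[<] 1) (𝓝 (2 - x - 1 / x)) := by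
      have hc : ContinuousAt (fun a => a * (2 - 1 / D a - D a)) 1 := by
        fun_prop (disch := assumption)
      have h := hc.tendsto
      simp only [hD1, one_div_one_div, one_mul] at h
      exact h.mono_left nhdsWithin_le_nhds
    have hlt : ∀ᶠ a in 𝓝[<] (1 : ℝ), D a < y / a := by
      have hc : ContinuousAt (fun a : ℝ => y / a) 1 := by
        fun_prop (disch := norm_num)
      exact (hDc.eventually_lt hc (by simpa [hD1] using hy)).filter_mono nhdsWithin_le_nhds
    refine le_of_tendsto hlim ?_
    filter_upwards [hlt, Ioo_mem_nhdsLT h1] with a hDa ha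
    refine hb ⟨a, ha, D a, ⟨?_, hDa⟩, rfl⟩
    have := ha.2
    simp only [D]
    linarith


/-- For `x, y > 0` with `y > 1/x` if `x ≤ 1` and `y > 2 - x` if `x ≥ 1`, and
`α₀, α₁` defined as in the positivity interval, the supremum of
`{α(2 - 1/δ - δ) : α ∈ (α₀, α₁), δ ∈ (δ₀(α), δ₁(α))}`, where
`δ₀(α) = α/(x-2+2α)` and `δ₁(α) = y/α`, equals `2 - x - 1/x` if `x ≤ 1`
and `0` if `x ≥ 1`. -/
theorem sup_second_maximization (x y : ℝ) (hx : 0 < x) (hy : 0 < y)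
    (hcond : (x ≤ 1 → y > 1 / x) ∧ (1 ≤ x → y > 2 - x))
    (α₀ α₁ : ℝ)
    (hα₀ : α₀ = if x ≤ 2 then y - Real.sqrt (y * (x + y - 2)) else 0)
    (hα₁ : α₁ = if y ≤ 1 / x then y + Real.sqrt (y * (x + y - 2)) else 1) :
    (x ≤ 1 →
      sSup {z : ℝ | ∃ α ∈ Set.Ioo α₀ α₁, ∃ δ ∈ Set.Ioo (α / (x - 2 + 2 * α)) (y / α),
        z = α * (2 - 1 / δ - δ)} = 2 - x - 1 / x) ∧
    (1 ≤ x →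
      sSup {z : ℝ | ∃ α ∈ Set.Ioo α₀ α₁, ∃ δ ∈ Set.Ioo (α / (x - 2 + 2 * α)) (y / α),
        z = α * (2 - 1 / δ - δ)} = 0) := by
  have hfirst : x ≤ 1 →
      sSup {z : ℝ | ∃ α ∈ Set.Ioo α₀ α₁, ∃ δ ∈ Set.Ioo (α / (x - 2 + 2 * α)) (y / α),
        z = α * (2 - 1 / δ - δ)} = 2 - x - 1 / x := by
    intro hx1
    have hyx := hcond.1 hx1
    have hxy : 1 < x * y := by
      rw [gt_iff_lt, div_lt_iff₀ hx] at hyx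
      linarith
    have hsum : 2 < x + y := by nlinarith [sq_nonneg (x - 1)]
    rw [if_pos (by linarith)] at hα₀
    rw [if_neg (by linarith)] at hα₁
    have h0 := half_le_lower_root (by linarith) hsum
    have h1 := lower_root_lt_one hxy
    rw [← hα₀] at h0 h1
    subst hα₁
    have hlub := isLUB_second_maximization hx hx1 hyx h0 h1
    exact hlub.csSup_eq hlub.nonempty
  refine ⟨hfirst, fun hx1 => ?_⟩
  rcases hx1.eq_or_lt with rfl | hx1'
  · rw [hfirst le_rfl]
    norm_num
  have hsum : 2 < x + y := by linarith [hcond.2 hx1]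
  have hlow : 0 ≤ α₀ ∧ (2 - x) / 2 ≤ α₀ ∧ α₀ ≤ max (2 - x) 0 := by
    split_ifs at hα₀ with h
    · have h0 := half_le_lower_root h hsum
      rw [← hα₀] at h0
      refine ⟨by linarith, h0, le_max_of_le_left ?_⟩
      rw [hα₀]
      exact lower_root_le_two_sub h hsum
    · exact ⟨hα₀.ge, by linarith, hα₀.le.trans (le_max_right _ _)⟩
  have hupp : min y 1 ≤ α₁ := by
    split_ifs at hα₁
    · exact (min_le_left _ _).trans (by linarith [Real.sqrt_nonneg (y * (x + y - 2))])
    · exact (min_le_right _ _).trans hα₁.ge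
  refine IsGreatest.csSup_eq ⟨?_, ?_⟩
  · obtain ⟨a, ha, ha'⟩ := exists_between (show max (2 - x) 0 < min y 1 from
      max_lt (lt_min (by linarith) (by linarith)) (lt_min hy one_pos))
    obtain ⟨ha2, ha0⟩ := max_lt_iff.1 ha
    refine ⟨a, ⟨hlow.2.2.trans_lt ha, ha'.trans_le hupp⟩, 1, ⟨?_, ?_⟩, by norm_num⟩
    · exact (div_lt_one (by linarith)).2 (by linarith)
    · exact (one_lt_div ha0).2 (lt_min_iff.1 ha').1
  · rintro z ⟨a, ⟨ha, -⟩, d, ⟨hd, -⟩, rfl⟩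
    have ha0 : 0 < a := hlow.1.trans_lt ha
    exact mul_two_sub_inv_sub_nonpos ha0
      ((div_pos ha0 (by linarith [hlow.2.1])).trans hd)
end

section
/- Let C ∈ (0,1], A > 0, M > 0 be real numbers, let s₀ ∈ ℝ and r ∈ ℝ. Define κ₀ := r² − 2M|s₀|/C + A/C² if |s₀| ≤ A/(C·M), and κ₀ := r² − M²s₀²/A if |s₀| ≥ A/(C·M). Then for all real numbers d, l ≥ 0 with l ≤ C·d one has A·d² − 2M|s₀|·d·l + r²·l² ≥ κ₀·l². -/
/-- For `C ∈ (0,1]`, `A, M > 0`, `s₀, r ∈ ℝ`, with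
`κ₀ = r² - 2M|s₀|/C + A/C²` if `|s₀| ≤ A/(CM)` and `κ₀ = r² - M²s₀²/A` if
`|s₀| ≥ A/(CM)`, one has `Ad² - 2M|s₀|dl + r²l² ≥ κ₀l²` for all `d, l ≥ 0`
with `l ≤ Cd`. -/
theorem poincare_l2_coercivity (C A M : ℝ) (hC0 : 0 < C) (hC1 : C ≤ 1)
    (hA : 0 < A) (hM : 0 < M) (s₀ r : ℝ) (κ₀ : ℝ)
    (hκ₀ : κ₀ = if |s₀| ≤ A / (C * M) then r ^ 2 - 2 * M * |s₀| / C + A / C ^ 2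
      else r ^ 2 - M ^ 2 * s₀ ^ 2 / A) :
    ∀ d l : ℝ, 0 ≤ d → 0 ≤ l → l ≤ C * d →
      A * d ^ 2 - 2 * M * |s₀| * d * l + r ^ 2 * l ^ 2 ≥ κ₀ * l ^ 2 := by
  intro d l _ hl hld
  rw [hκ₀, ge_iff_le, ← sub_nonneg]
  split_ifs with h
  · obtain ⟨x, rfl⟩ : ∃ x, l = C * x := ⟨l / C, by field_simp⟩
    have hx : 0 ≤ x := nonneg_of_mul_nonneg_right hl hC0
    have hxd : 0 ≤ d - x := sub_nonneg.2 (le_of_mul_le_mul_left hld hC0)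
    have hs : 0 ≤ A - |s₀| * (C * M) :=
      sub_nonneg.2 ((le_div_iff₀ (mul_pos hC0 hM)).1 h)
    have key : A * d ^ 2 - 2 * M * |s₀| * d * (C * x) + r ^ 2 * (C * x) ^ 2 -
        (r ^ 2 - 2 * M * |s₀| / C + A / C ^ 2) * (C * x) ^ 2 =
        A * (d - x) ^ 2 + 2 * ((A - |s₀| * (C * M)) * x * (d - x)) := by
      field_simp
      ring
    rw [key]
    positivity
  · have key : A * d ^ 2 - 2 * M * |s₀| * d * l + r ^ 2 * l ^ 2 -
        (r ^ 2 - M ^ 2 * s₀ ^ 2 / A) * l ^ 2 = (A * d - M * |s₀| * l) ^ 2 / A := by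
      rw [← sq_abs s₀]
      field_simp
      ring
    rw [key]
    positivity
end
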